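/- arXiv:1807.08609 — 2 statements merged into one kernel-verified Lean document; each statement's English description precedes it below -/
import Mathlib

section
/- Let Λ(t) = λ ∫₀ᵗ (1-B(x)) dx and define Pₙ(t) = e^{-Λ(t) - vt} Λ(t)ⁿ/n! + v ∫₀ᵗ e^{-(Λ(t)-Λ(u)) - v(t-u)} (Λ(t)-Λ(u))ⁿ/n! du for n ≥ 0. Then P₀(0) = 1, Pₙ(0) = 0 for n ≥ 1, Σ_{n=0}^∞ Pₙ(t) = 1 for every t ≥ 0, and the functions satisfy the system of Kolmogorov differential equations P₀'(t) = -[λ(1-B(t)) + v]·P₀(t) + v and, for n ≥ 1, Pₙ'(t) = -[λ(1-B(t)) + v]·Pₙ(t) + λ(1-B(t))·P_{n-1}(t). -/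
open Finset in
theorem add_pow_div_factorial (x y : ℝ) (n : ℕ) :
    (x + y) ^ n / n.factorial =
      ∑ p ∈ antidiagonal n, x ^ p.1 / p.1.factorial * (y ^ p.2 / p.2.factorial) := by
  rw [(Commute.all x y).add_pow', sum_div]
  refine sum_congr rfl fun p hp => ?_
  obtain ⟨i, j⟩ := p
  obtain rfl : i + j = n := by simpa using hp
  have h : ((i + j).choose i : ℝ) * i.factorial * j.factorial = (i + j).factorial := by
    rw [Nat.choose_symm_add]
    exact_mod_cast Nat.add_choose_mul_factorial_mul_factorial i j
  simp only [nsmul_eq_mul]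
  field_simp
  rw [← h]
  ring

open Finset in
theorem integral_mul_sub_pow_div_factorial {w a : ℝ → ℝ} (hw : Continuous w) (ha : Continuous a)
    (n : ℕ) (x s : ℝ) :
    ∫ u in (0:ℝ)..s, w u * ((x - a u) ^ n / n.factorial) =
      ∑ p ∈ antidiagonal n, x ^ p.1 / p.1.factorial *
        ∫ u in (0:ℝ)..s, w u * ((-a u) ^ p.2 / p.2.factorial) := by
  simp_rw [← intervalIntegral.integral_const_mul]
  rw [← intervalIntegral.integral_finsetSum
    fun p _ => Continuous.intervalIntegrable (by fun_prop) _ _]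
  refine intervalIntegral.integral_congr fun u _ => ?_
  simp only [sub_eq_add_neg x, add_pow_div_factorial, mul_sum]
  exact sum_congr rfl fun p _ => by ring

theorem hasDerivAt_pow_succ_div_factorial {a : ℝ → ℝ} {a' t : ℝ} (hat : HasDerivAt a a' t)
    (n : ℕ) :
    HasDerivAt (fun s => a s ^ (n + 1) / (n + 1).factorial) (a' * (a t ^ n / n.factorial)) t := by
  refine ((hat.fun_pow (n + 1)).div_const ((n + 1).factorial : ℝ)).congr_deriv ?_
  rw [Nat.factorial_succ]
  push_cast
  field_simp

open Finset in
theorem hasDerivAt_integral_mul_sub_pow_succ {w a : ℝ → ℝ} {a' t : ℝ} (hw : Continuous w)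
    (ha : Continuous a) (hat : HasDerivAt a a' t) (n : ℕ) :
    HasDerivAt (fun s => ∫ u in (0:ℝ)..s, w u * ((a s - a u) ^ (n + 1) / (n + 1).factorial))
      (a' * ∫ u in (0:ℝ)..t, w u * ((a t - a u) ^ n / n.factorial)) t := by
  simp_rw [integral_mul_sub_pow_div_factorial hw ha]
  have hM (j : ℕ) : HasDerivAt (fun s => ∫ u in (0:ℝ)..s, w u * ((-a u) ^ j / j.factorial))
      (w t * ((-a t) ^ j / j.factorial)) t :=
    Continuous.integral_hasStrictDerivAt (f := fun u => w u * ((-a u) ^ j / j.factorial)) (by fun_prop) 0 t |>.hasDerivAt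
  have hzero : ∑ p ∈ antidiagonal (n + 1), a t ^ p.1 / p.1.factorial *
      (w t * ((-a t) ^ p.2 / p.2.factorial)) = 0 := by
    simp_rw [mul_left_comm _ (w t)]
    rw [← mul_sum, ← add_pow_div_factorial]
    simp
  simp_rw [Nat.sum_antidiagonal_succ] at hzero ⊢
  have hsum := HasDerivAt.fun_sum (u := antidiagonal n) fun p _ =>
    (hasDerivAt_pow_succ_div_factorial hat p.1).mul (hM p.2)
  refine (((hM (n + 1)).const_mul (a t ^ 0 / (Nat.factorial 0 : ℝ))).add hsum).congr_deriv ?_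
    |>.congr_of_eventuallyEq ?_
  · rw [sum_add_distrib, add_left_comm, hzero, add_zero, mul_sum]
    exact sum_congr rfl fun p _ => by ring
  · exact Filter.Eventually.of_forall fun s => by simp

theorem hasSum_pow_div_factorial (x : ℝ) :
    HasSum (fun n : ℕ => x ^ n / n.factorial) (Real.exp x) := by
  rw [Real.exp_eq_exp_ℝ]
  exact NormedSpace.expSeries_div_hasSum_exp x

theorem hasSum_integral_mul_pow_div_factorial {w b : ℝ → ℝ} (hw : Continuous w)
    (hb : Continuous b) (t : ℝ) :
    HasSum (fun n : ℕ => ∫ u in (0:ℝ)..t, w u * (b u ^ n / n.factorial))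
      (∫ u in (0:ℝ)..t, w u * Real.exp (b u)) := by
  refine intervalIntegral.hasSum_integral_of_dominated_convergence
    (fun n u => |w u| * (|b u| ^ n / n.factorial))
    (fun n => Continuous.aestronglyMeasurable (by fun_prop)) ?_ ?_ ?_ ?_
  · intro n
    filter_upwards with u _
    simp
  · filter_upwards with u _
    exact ((hasSum_pow_div_factorial |b u|).mul_left _).summable
  · simp_rw [fun u => ((hasSum_pow_div_factorial |b u|).mul_left |w u|).tsum_eq]
    exact Continuous.intervalIntegrable (by fun_prop) _ _
  · filter_upwards with u _
    exact (hasSum_pow_div_factorial (b u)).mul_left _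

/-- With `Λ(t) = λ ∫₀ᵗ (1-B(x)) dx`, the transient probabilities (11)
`Pₙ(t) = e^{-Λ(t)-vt} Λ(t)ⁿ/n! + v ∫₀ᵗ e^{-(Λ(t)-Λ(u))-v(t-u)} (Λ(t)-Λ(u))ⁿ/n! du`
satisfy `P₀(0) = 1`, `Pₙ(0) = 0` for `n ≥ 1`, `Σₙ Pₙ(t) = 1` for every `t ≥ 0`, and the
Kolmogorov system (4): `P₀' = -[λ(1-B(t))+v]P₀ + v` and, for `n ≥ 1`,
`Pₙ' = -[λ(1-B(t))+v]Pₙ + λ(1-B(t))P_{n-1}`. -/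
theorem stmt_6 (lam v : ℝ) (hlam : 0 < lam) (hv : 0 < v)
    (B : ℝ → ℝ) (hBcont : Continuous B) (hB : ∀ x, 0 ≤ x → 0 ≤ B x ∧ B x ≤ 1)
    (Lam : ℝ → ℝ) (hLam : ∀ t, Lam t = lam * ∫ x in (0:ℝ)..t, (1 - B x))
    (P : ℕ → ℝ → ℝ)
    (hP : ∀ n : ℕ, ∀ t, P n t =
      Real.exp (-Lam t - v * t) * Lam t ^ n / n.factorial +
        v * ∫ u in (0:ℝ)..t,
          Real.exp (-(Lam t - Lam u) - v * (t - u)) * (Lam t - Lam u) ^ n / n.factorial) :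
    P 0 0 = 1 ∧ (∀ n : ℕ, 1 ≤ n → P n 0 = 0) ∧
    (∀ t, 0 ≤ t → ∑' n : ℕ, P n t = 1) ∧
    (∀ t, 0 ≤ t →
      HasDerivAt (P 0) (-(lam * (1 - B t) + v) * P 0 t + v) t) ∧
    (∀ n : ℕ, ∀ t, 0 ≤ t →
      HasDerivAt (P (n + 1))
        (-(lam * (1 - B t) + v) * P (n + 1) t + lam * (1 - B t) * P n t) t) := by
  have hLam_deriv (t : ℝ) : HasDerivAt Lam (lam * (1 - B t)) t := by
    rw [funext hLam]
    exact ((Continuous.integral_hasStrictDerivAt (f := fun x => 1 - B x) (by fun_prop)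
      0 t).hasDerivAt).const_mul lam
  have hLam_cont : Continuous Lam :=
    continuous_iff_continuousAt.2 fun t => (hLam_deriv t).continuousAt
  have hLam_zero : Lam 0 = 0 := by simp [hLam]
  set w : ℝ → ℝ := fun u => Real.exp (Lam u + v * u) with hw
  have hw_cont : Continuous w := by fun_prop
  have hP_eq (n : ℕ) (t : ℝ) : P n t = Real.exp (-Lam t - v * t) *
      (Lam t ^ n / n.factorial +
        v * ∫ u in (0:ℝ)..t, w u * ((Lam t - Lam u) ^ n / n.factorial)) := by
    rw [hP, mul_add, mul_div_assoc, mul_left_comm,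
      ← intervalIntegral.integral_const_mul (Real.exp (-Lam t - v * t))]
    congr 2
    refine intervalIntegral.integral_congr fun u _ => ?_
    simp only [hw]
    rw [← mul_assoc, ← Real.exp_add, mul_div_assoc]
    congr 2
    ring
  have hE (t : ℝ) : HasDerivAt (fun s => Real.exp (-Lam s - v * s))
      (Real.exp (-Lam t - v * t) * (-(lam * (1 - B t)) - v)) t := by
    simpa using ((hLam_deriv t).neg.sub ((hasDerivAt_id t).const_mul v)).exp
  refine ⟨by simp [hP, hLam_zero], fun n hn => ?_, fun t _ => ?_, fun t _ => ?_, fun n t _ => ?_⟩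
  · simp [hP, hLam_zero, Nat.one_le_iff_ne_zero.1 hn]
  · have hsum := ((hasSum_pow_div_factorial (Lam t)).add ((hasSum_integral_mul_pow_div_factorial hw_cont
      (b := fun u => Lam t - Lam u) (by fun_prop) t).mul_left v)).mul_left
        (Real.exp (-Lam t - v * t))
    simp_rw [hP_eq, hsum.tsum_eq]
    have hint : v * ∫ u in (0:ℝ)..t, w u * Real.exp (Lam t - Lam u) =
        Real.exp (Lam t) * (Real.exp (v * t) - 1) := by
      have hcongr (u : ℝ) : w u * Real.exp (Lam t - Lam u) =
          Real.exp (Lam t) * Real.exp (v * u) := by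
        simp only [hw]
        rw [← Real.exp_add, ← Real.exp_add]
        congr 1
        ring
      simp_rw [hcongr]
      rw [intervalIntegral.integral_const_mul, mul_left_comm,
        intervalIntegral.mul_integral_comp_mul_left (f := Real.exp)]
      simp
    rw [hint, ← mul_one_add, add_sub_cancel, ← Real.exp_add, ← Real.exp_add]
    simp
  · rw [funext (hP_eq 0)]
    have hI := Continuous.integral_hasStrictDerivAt hw_cont 0 t |>.hasDerivAt
    have hinv : Real.exp (-Lam t - v * t) * w t = 1 := by
      simp only [hw]
      rw [← Real.exp_add]
      simp
    simp only [pow_zero, Nat.factorial_zero, Nat.cast_one, div_one, mul_one]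
    refine ((hE t).fun_mul ((hI.const_mul v).const_add 1)).congr_deriv ?_
    linear_combination v * hinv
  · rw [funext (hP_eq (n + 1)), hP_eq n]
    refine ((hE t).fun_mul ((hasDerivAt_pow_succ_div_factorial (hLam_deriv t) n).fun_add
      ((hasDerivAt_integral_mul_sub_pow_succ hw_cont hLam_cont
        (hLam_deriv t) n).const_mul v))).congr_deriv ?_
    ring
end

section
/- Let λ > 0, v > 0, b > 0. Define p₀(t) = e^{-λ·min(t,b)} and P₀(t) = p₀(t) e^{-vt} + v ∫₀ᵗ p₀(t-u) e^{-v(t-u)} du. Then for every s > 0, ∫₀^∞ e^{-st} P₀(t) dt = (s + v + λ e^{-(λ+s+v)b}) / (s (λ+s+v)), and consequently s · ∫₀^∞ e^{-st} P₀(t) dt tends to (v + λ e^{-(λ+v)b})/(λ+v) as s → 0⁺. -/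
open MeasureTheory Filter

lemma integral_exp_neg_mul {k : ℝ} (hk : k ≠ 0) (p q : ℝ) :
    ∫ x in p..q, Real.exp (-(k * x)) = (Real.exp (-(k * p)) - Real.exp (-(k * q))) / k := by
  have hderiv : ∀ x ∈ Set.uIcc p q,
      HasDerivAt (fun x => -Real.exp (-(k * x)) / k) (Real.exp (-(k * x))) x := by
    intro x _
    have h := ((((hasDerivAt_id x).const_mul k).neg.exp).neg).div_const k
    refine h.congr_deriv ?_
    simp only [id, Pi.neg_apply]
    field_simp
  rw [intervalIntegral.integral_eq_sub_of_hasDerivAt hderiv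
    (Continuous.intervalIntegrable (by fun_prop) _ _)]
  ring

lemma integral_exp_neg_mul_min_mul_exp {lam r b t : ℝ} (hlam : 0 < lam) (hr : 0 < r)
    (hb : 0 < b) (hbt : b ≤ t) :
    ∫ x in (0:ℝ)..t, Real.exp (-(lam * min x b)) * Real.exp (-(r * x)) =
      (1 - Real.exp (-((lam + r) * b))) / (lam + r) +
        Real.exp (-(lam * b)) * ((Real.exp (-(r * b)) - Real.exp (-(r * t))) / r) := by
  have hc : Continuous fun x : ℝ => Real.exp (-(lam * min x b)) * Real.exp (-(r * x)) := by
    fun_prop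
  rw [← intervalIntegral.integral_add_adjacent_intervals (hc.intervalIntegrable 0 b)
    (hc.intervalIntegrable b t)]
  congr 1
  · rw [intervalIntegral.integral_congr (g := fun x => Real.exp (-((lam + r) * x))),
      integral_exp_neg_mul (by positivity)]
    · simp
    · intro x hx
      rw [Set.uIcc_of_le hb.le] at hx
      simp only [min_eq_left hx.2, ← Real.exp_add]
      ring_nf
  · rw [intervalIntegral.integral_congr
      (g := fun x => Real.exp (-(lam * b)) * Real.exp (-(r * x))),
      intervalIntegral.integral_const_mul, integral_exp_neg_mul hr.ne']
    intro x hx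
    rw [Set.uIcc_of_le hbt] at hx
    simp only [min_eq_right hx.1]

lemma tendsto_exp_neg_mul_atTop {k : ℝ} (hk : 0 < k) :
    Tendsto (fun t : ℝ => Real.exp (-(k * t))) atTop (nhds 0) :=
  Real.tendsto_exp_neg_atTop_nhds_zero.comp (tendsto_id.const_mul_atTop hk)

lemma tendsto_integral_exp_neg_mul_min_mul_exp {lam r b : ℝ} (hlam : 0 < lam) (hr : 0 < r)
    (hb : 0 < b) :
    Tendsto (fun t => ∫ x in (0:ℝ)..t, Real.exp (-(lam * min x b)) * Real.exp (-(r * x)))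
      atTop (nhds ((1 - Real.exp (-((lam + r) * b))) / (lam + r) +
        Real.exp (-(lam * b)) * ((Real.exp (-(r * b)) - 0) / r))) := by
  refine Tendsto.congr' ?_ ((((tendsto_exp_neg_mul_atTop hr).const_sub _).div_const
    r).const_mul _ |>.const_add _)
  filter_upwards [eventually_ge_atTop b] with t ht
  exact (integral_exp_neg_mul_min_mul_exp hlam hr hb ht).symm

/-- For the `M|D|∞` queue with catastrophes, with
`p₀(t) = e^{-λ·min(t,b)}` and `P₀(t) = p₀(t)e^{-vt} + v ∫₀ᵗ p₀(t-u) e^{-v(t-u)} du`,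
the Laplace transform is (34): for every `s > 0`,
`∫₀^∞ e^{-st} P₀(t) dt = (s + v + λe^{-(λ+s+v)b}) / (s(λ+s+v))`, and consequently
`s·∫₀^∞ e^{-st} P₀(t) dt → (v + λe^{-(λ+v)b})/(λ+v)` as `s → 0⁺`. -/
theorem stmt_17 (lam v b : ℝ) (hlam : 0 < lam) (hv : 0 < v) (hb : 0 < b)
    (p₀ P₀ : ℝ → ℝ)
    (hp₀ : ∀ t, 0 ≤ t → p₀ t = Real.exp (-(lam * min t b)))
    (hP₀ : ∀ t, 0 ≤ t → P₀ t =
      p₀ t * Real.exp (-(v * t)) +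
        v * ∫ u in (0:ℝ)..t, p₀ (t - u) * Real.exp (-(v * (t - u)))) :
    (∀ s : ℝ, 0 < s →
      (∫ t in Set.Ioi (0:ℝ), Real.exp (-(s * t)) * P₀ t) =
        (s + v + lam * Real.exp (-((lam + s + v) * b))) / (s * (lam + s + v))) ∧
    Tendsto (fun s : ℝ => s * ∫ t in Set.Ioi (0:ℝ), Real.exp (-(s * t)) * P₀ t)
      (nhdsWithin 0 (Set.Ioi 0))
      (nhds ((v + lam * Real.exp (-((lam + v) * b))) / (lam + v))) := by
  have hg : Continuous fun x : ℝ => Real.exp (-(lam * min x b)) * Real.exp (-(v * x)) := by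
    fun_prop
  have hP : ∀ t, 0 ≤ t → P₀ t = Real.exp (-(lam * min t b)) * Real.exp (-(v * t)) +
      v * ∫ x in (0:ℝ)..t, Real.exp (-(lam * min x b)) * Real.exp (-(v * x)) := by
    intro t ht
    rw [hP₀ t ht, hp₀ t ht, intervalIntegral.integral_comp_sub_left
      (fun x => p₀ x * Real.exp (-(v * x))) t, sub_self, sub_zero]
    congr 2
    refine intervalIntegral.integral_congr fun x hx => ?_
    rw [Set.uIcc_of_le ht] at hx
    simp only [hp₀ x hx.1]
  have hP_nonneg : ∀ t, 0 ≤ t → 0 ≤ P₀ t := by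
    intro t ht
    rw [hP t ht]
    have := intervalIntegral.integral_nonneg (μ := volume) ht
      (f := fun x => Real.exp (-(lam * min x b)) * Real.exp (-(v * x)))
      fun x _ => by positivity
    positivity
  have hmain : ∀ s : ℝ, 0 < s →
      (∫ t in Set.Ioi (0:ℝ), Real.exp (-(s * t)) * P₀ t) =
        (s + v + lam * Real.exp (-((lam + s + v) * b))) / (s * (lam + s + v)) := by
    intro s hs
    have hk : Continuous fun x : ℝ =>
        Real.exp (-(lam * min x b)) * Real.exp (-((s + v) * x)) := by fun_prop
    have hderiv : ∀ t ∈ Set.Ici (0:ℝ), HasDerivAt (fun t =>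
        -(v / s) * (Real.exp (-(s * t)) *
          ∫ x in (0:ℝ)..t, Real.exp (-(lam * min x b)) * Real.exp (-(v * x))) +
        (1 + v / s) *
          ∫ x in (0:ℝ)..t, Real.exp (-(lam * min x b)) * Real.exp (-((s + v) * x)))
        (Real.exp (-(s * t)) * P₀ t) t := by
      intro t ht
      have h := ((((hasDerivAt_id t).const_mul s).neg.exp.mul
        (hg.integral_hasStrictDerivAt 0 t).hasDerivAt).const_mul (-(v / s))).add
        ((hk.integral_hasStrictDerivAt 0 t).hasDerivAt.const_mul (1 + v / s))
      refine h.congr_deriv ?_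
      have he : Real.exp (-((s + v) * t)) = Real.exp (-(s * t)) * Real.exp (-(v * t)) := by
        rw [← Real.exp_add]
        ring_nf
      simp only [id, Pi.neg_apply]
      rw [hP t ht, he]
      field_simp
      ring
    have hlim := (((tendsto_exp_neg_mul_atTop hs).mul
      (tendsto_integral_exp_neg_mul_min_mul_exp hlam hv hb)).const_mul (-(v / s))).add
      ((tendsto_integral_exp_neg_mul_min_mul_exp hlam (add_pos hs hv) hb).const_mul
        (1 + v / s))
    rw [integral_Ioi_of_hasDerivAt_of_nonneg
      (hderiv 0 Set.self_mem_Ici).continuousAt.continuousWithinAt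
      (fun t ht => hderiv t (Set.Ioi_subset_Ici_self ht))
      (fun t ht => mul_nonneg (Real.exp_pos _).le (hP_nonneg t (le_of_lt ht))) hlim]
    have he : Real.exp (-((lam + s + v) * b)) =
        Real.exp (-(lam * b)) * Real.exp (-((s + v) * b)) := by
      rw [← Real.exp_add]
      ring_nf
    rw [← add_assoc lam s v, he]
    simp only [intervalIntegral.integral_same]
    field_simp
    ring
  refine ⟨hmain, ?_⟩
  have hcont : ContinuousAt (fun s : ℝ =>
      (s + v + lam * Real.exp (-((lam + s + v) * b))) / (lam + s + v)) 0 := by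
    refine ContinuousAt.div (by fun_prop) (by fun_prop) ?_
    positivity
  have hlim := hcont.tendsto.mono_left (nhdsWithin_le_nhds (s := Set.Ioi 0))
  simp only [zero_add, add_zero] at hlim
  refine hlim.congr' ?_
  filter_upwards [self_mem_nhdsWithin] with s hs
  have hs : 0 < s := hs
  rw [hmain s hs]
  field_simp
end
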